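/- Let δ = δ_P be the conformal dimension of the prime Cantor set Λ_P and μ_P its conformal measure. Let ψ(r) = r^δ · log^s(1/r) with s > (1-δ)/(2δ-1). Then H^ψ(μ_P) = ∞, and consequently H^ψ(Λ_P) = ∞. -/

import Mathlib

open MeasureTheory Metric Filter Set
open scoped ENNReal Topology NNReal

noncomputable section

/-- The Gauss map `φ_a(x) = 1/(a+x)`. -/
def gaussMap (a : ℕ) (x : ℝ) : ℝ := 1 / (a + x)

/-- `φ_ω = φ_{ω₁} ∘ ⋯ ∘ φ_{ω_n}` for a finite word `ω`. -/
def wordMap : List ℕ → ℝ → ℝ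
  | [] => fun x => x
  | a :: ω => fun x => gaussMap a (wordMap ω x)

/-- `‖φ_ω'‖ = sup_{x ∈ [0,1]} |φ_ω'(x)|`. -/
def derivNorm (ω : List ℕ) : ℝ := ⨆ x : Icc (0 : ℝ) 1, |deriv (wordMap ω) (x : ℝ)|

/-- The cylinder `[ω] = φ_ω([0,1])`. -/
def cyl (ω : List ℕ) : Set ℝ := wordMap ω '' Icc 0 1

/-- The set of finite words over the alphabet `E`. -/
def words (E : Set ℕ) : Set (List ℕ) := {ω | ∀ a ∈ ω, a ∈ E}

/-- The coding map `π(ω) = [0; ω₀, ω₁, …]`. -/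
def codingMap (ω : ℕ → ℕ) : ℝ :=
  limUnder atTop fun n => wordMap (List.ofFn fun i : Fin n => ω i) 0

/-- The limit set `Λ_E`. -/
def limitSet (E : Set ℕ) : Set ℝ := codingMap '' {ω | ∀ n, ω n ∈ E}

/-- The pressure function of the Gauss IFS on the alphabet `E`. -/
def pressure (E : Set ℕ) (s : ℝ) : ℝ :=
  limUnder atTop fun n : ℕ =>
    (n : ℝ)⁻¹ * Real.log (∑' ω : Fin n → E, derivNorm (List.ofFn fun i => (ω i : ℕ)) ^ s)

/-- `μ` is the `δ`-conformal measure of the Gauss IFS on the alphabet `E`. -/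
def IsConformal (E : Set ℕ) (δ : ℝ) (μ : Measure ℝ) : Prop :=
  IsProbabilityMeasure μ ∧ μ (limitSet E)ᶜ = 0 ∧
    ∀ A : Set ℝ, A ⊆ Icc 0 1 → MeasurableSet A →
      μ A = ∑' a : E, ENNReal.ofReal (∫ x in gaussMap (a : ℕ) ⁻¹' A, |deriv (gaussMap (a : ℕ)) x| ^ δ ∂μ)

/-- The set of prime numbers. -/
def primes : Set ℕ := {p | p.Prime}

/-- `μ(J) = ∑_{a ∈ J} μ([a])` for a set of letters `J`. -/
def cylMass (μ : Measure ℝ) (J : Set ℕ) : ℝ≥0∞ := ∑' a : J, μ (cyl [(a : ℕ)])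

/-- A dimension function: continuous, increasing, positive, with `ψ(0⁺) = 0`. -/
def IsDimFun (ψ : ℝ → ℝ) : Prop :=
  ContinuousOn ψ (Ioi 0) ∧ MonotoneOn ψ (Ioi 0) ∧ (∀ r : ℝ, 0 < r → 0 < ψ r) ∧
    Tendsto ψ (𝓝[>] (0 : ℝ)) (𝓝 0)

/-- A doubling function. -/
def IsDoubling (ψ : ℝ → ℝ) : Prop :=
  ∀ C₁ : ℝ, 1 ≤ C₁ → ∃ C₂ : ℝ, 1 ≤ C₂ ∧ ∀ x y : ℝ, 0 < x → 0 < y →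
    C₁⁻¹ ≤ x / y → x / y ≤ C₁ → C₂⁻¹ ≤ ψ x / ψ y ∧ ψ x / ψ y ≤ C₂

open Classical in
/-- The `ψ`-dimensional Hausdorff measure `H^ψ`. -/
def hausdorffPsi (ψ : ℝ → ℝ) : Measure ℝ :=
  Measure.mkMetric fun d => if d = 0 then 0 else ENNReal.ofReal (ψ d.toReal)

/-- `H^ψ(μ) = inf {H^ψ(A) : A Borel, μ(ℝ∖A) = 0}`. -/
def hausdorffPsiOf (ψ : ℝ → ℝ) (μ : Measure ℝ) : ℝ≥0∞ :=
  ⨅ (A : Set ℝ) (_ : MeasurableSet A) (_ : μ Aᶜ = 0), hausdorffPsi ψ A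

/-- The `ψ`-dimensional packing pre-measure `P̃^ψ`. -/
def packingPre (ψ : ℝ → ℝ) (A : Set ℝ) : ℝ≥0∞ :=
  ⨅ (ε : ℝ) (_ : 0 < ε),
    ⨆ (D : Set (ℝ × ℝ)) (_ : D.Countable)
      (_ : ∀ p ∈ D, p.1 ∈ A ∧ 0 < p.2 ∧ 2 * p.2 ≤ ε)
      (_ : D.PairwiseDisjoint fun p => closedBall p.1 p.2),
      ∑' p : D, ENNReal.ofReal (ψ (2 * (p : ℝ × ℝ).2))

/-- The `ψ`-dimensional packing measure `P^ψ`. -/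
def packingPsi (ψ : ℝ → ℝ) (A : Set ℝ) : ℝ≥0∞ :=
  ⨅ (S : ℕ → Set ℝ) (_ : A ⊆ ⋃ i, S i), ∑' i, packingPre ψ (S i)

/-- `P^ψ(μ) = inf {P^ψ(A) : A Borel, μ(ℝ∖A) = 0}`. -/
def packingPsiOf (ψ : ℝ → ℝ) (μ : Measure ℝ) : ℝ≥0∞ :=
  ⨅ (A : Set ℝ) (_ : MeasurableSet A) (_ : μ Aᶜ = 0), packingPsi ψ A

/-- Assumption C with constant `λ`: `μ({a : λ⁻¹r < ‖φ_a'‖ ≤ r}) ≍ μ({a : ‖φ_a'‖ ≤ r})`. -/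
def AssumptionC (E : Set ℕ) (μ : Measure ℝ) (lam : ℝ) : Prop :=
  ∃ c C : ℝ≥0∞, 0 < c ∧ C ≠ ⊤ ∧ ∀ r : ℝ, 0 < r → r ≤ 1 →
    c * cylMass μ {a ∈ E | derivNorm [a] ≤ r} ≤
        cylMass μ {a ∈ E | lam⁻¹ * r < derivNorm [a] ∧ derivNorm [a] ≤ r} ∧
      cylMass μ {a ∈ E | lam⁻¹ * r < derivNorm [a] ∧ derivNorm [a] ≤ r} ≤
        C * cylMass μ {a ∈ E | derivNorm [a] ≤ r}

/-- `f` is regularly varying with exponent `s`. -/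
def RegVarying (f : ℝ → ℝ) (s : ℝ) : Prop :=
  ∀ a : ℝ, 1 < a → Tendsto (fun x => f (a * x) / f x) atTop (𝓝 (a ^ s))

/-- Assumption 1: `#(E ∩ [N,2N]) ≍ f(N)`. -/
def Assumption1 (E : Set ℕ) (f : ℝ → ℝ) : Prop :=
  ∃ c C : ℝ, 0 < c ∧ 0 < C ∧ ∀ N : ℕ, 1 ≤ N →
    c * f N ≤ ((E ∩ Icc N (2 * N)).ncard : ℝ) ∧ ((E ∩ Icc N (2 * N)).ncard : ℝ) ≤ C * f N

/-- Assumption 3: the Lyapunov exponent `-∑_{a∈E} μ(a) log ‖φ_a'‖` is finite. -/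
def Assumption3 (E : Set ℕ) (μ : Measure ℝ) : Prop :=
  Summable fun a : E => (μ (cyl [(a : ℕ)])).toReal * Real.log (derivNorm [(a : ℕ)])

/-- `W_k = {ω : λ^{-(k+1)} < ‖φ_ω'‖ ≤ λ^{-k}}`. -/
def W (lam : ℝ) (k : ℕ) : Set (List ℕ) :=
  {ω | lam ^ (-(k : ℝ) - 1) < derivNorm ω ∧ derivNorm ω ≤ lam ^ (-(k : ℝ))}

/-- `A_k = ⋃ {[ωa] : ω ∈ W_k ∩ E^*, a ∈ J}`. -/
def cylUnion (E : Set ℕ) (lam : ℝ) (k : ℕ) (J : Set ℕ) : Set ℝ :=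
  ⋃ ω ∈ W lam k ∩ words E, ⋃ a ∈ J, cyl (ω ++ [a])

/-- `S_J`: sequences in `E^ℕ` with infinitely many `(n,k)` such that `ω|n ∈ W_k`, `ω_{n+1} ∈ J_k`. -/
def Sset (E : Set ℕ) (lam : ℝ) (J : ℕ → Set ℕ) : Set (ℕ → ℕ) :=
  {ω | (∀ n, ω n ∈ E) ∧
    {p : ℕ × ℕ | (List.ofFn fun i : Fin p.1 => ω i) ∈ W lam p.2 ∧ ω p.1 ∈ J p.2}.Infinite}

/-- The upper density `D̄^ψ_μ(x)`. -/
def upperDensity (ψ : ℝ → ℝ) (μ : Measure ℝ) (x : ℝ) : ℝ≥0∞ :=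
  limsup (fun r => μ (closedBall x r) / ENNReal.ofReal (ψ r)) (𝓝[>] (0 : ℝ))

/-- The lower density `D̲^ψ_μ(x)`. -/
def lowerDensity (ψ : ℝ → ℝ) (μ : Measure ℝ) (x : ℝ) : ℝ≥0∞ :=
  liminf (fun r => μ (closedBall x r) / ENNReal.ofReal (ψ r)) (𝓝[>] (0 : ℝ))

/-- `J_{k,α,1} = {a ∈ E : ∃ r ∈ [‖φ_a'‖,1], r^{-δ} μ(B([a],r)) ≥ α Ψ(λ^{-k} r)}`. -/
def JsetH (E : Set ℕ) (δ : ℝ) (μ : Measure ℝ) (Ψ : ℝ → ℝ) (lam : ℝ) (k : ℕ) (α : ℝ) : Set ℕ :=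
  {a ∈ E | ∃ r : ℝ, derivNorm [a] ≤ r ∧ r ≤ 1 ∧
    ENNReal.ofReal (α * r ^ δ * Ψ (lam ^ (-(k : ℝ)) * r)) ≤ μ (cthickening r (cyl [a]))}

/-- `J_{k,α,-1} = {a ∈ E : ∃ r ∈ [‖φ_a'‖,1], r^{-δ} μ(B([a],r)) ≤ α Ψ(λ^{-k} r)}`. -/
def JsetP (E : Set ℕ) (δ : ℝ) (μ : Measure ℝ) (Ψ : ℝ → ℝ) (lam : ℝ) (k : ℕ) (α : ℝ) : Set ℕ :=
  {a ∈ E | ∃ r : ℝ, derivNorm [a] ≤ r ∧ r ≤ 1 ∧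
    μ (cthickening r (cyl [a])) ≤ ENNReal.ofReal (α * r ^ δ * Ψ (lam ^ (-(k : ℝ)) * r))}

/-- `S_{α,1}`. -/
def SsetH (E : Set ℕ) (δ : ℝ) (μ : Measure ℝ) (Ψ : ℝ → ℝ) (lam : ℝ) (α : ℝ) : Set (ℕ → ℕ) :=
  {ω | {p : ℕ × ℕ | (List.ofFn fun i : Fin p.1 => ω i) ∈ W lam p.2 ∧
    ω p.1 ∈ JsetH E δ μ Ψ lam p.2 α}.Infinite}

/-- `S_{α,-1}`. -/
def SsetP (E : Set ℕ) (δ : ℝ) (μ : Measure ℝ) (Ψ : ℝ → ℝ) (lam : ℝ) (α : ℝ) : Set (ℕ → ℕ) :=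
  {ω | {p : ℕ × ℕ | (List.ofFn fun i : Fin p.1 => ω i) ∈ W lam p.2 ∧
    ω p.1 ∈ JsetP E δ μ Ψ lam p.2 α}.Infinite}

/-- `M(x,pre,r) = ∑_{a ∈ E, [pre·a] ⊆ B(x,r)} μ([pre·a])`. -/
def Mform (E : Set ℕ) (μ : Measure ℝ) (x : ℝ) (pre : List ℕ) (r : ℝ) : ℝ≥0∞ :=
  ∑' a : {a : ℕ // a ∈ E ∧ cyl (pre ++ [a]) ⊆ closedBall x r}, μ (cyl (pre ++ [(a : ℕ)]))

/-- The pair `(q_n, q_{n-1})` of continued fraction denominators of a finite word. -/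
def denPair (ω : List ℕ) : ℝ × ℝ := ω.foldl (fun p a => (a * p.1 + p.2, p.1)) (1, 0)

lemma denPair_concat (ω : List ℕ) (a : ℕ) :
    denPair (ω ++ [a]) = (a * (denPair ω).1 + (denPair ω).2, (denPair ω).1) := by
  simp [denPair]

lemma wordMap_append (ω η : List ℕ) (x : ℝ) :
    wordMap (ω ++ η) x = wordMap ω (wordMap η x) := by
  induction ω with
  | nil => rfl
  | cons a ω ih => simp [wordMap, ih]

lemma denPair_bounds {ω : List ℕ} (h : ∀ a ∈ ω, 2 ≤ a) :
    0 ≤ (denPair ω).2 ∧ (denPair ω).2 ≤ (denPair ω).1 ∧ 2 ^ ω.length ≤ (denPair ω).1 := by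
  induction ω using List.reverseRecOn with
  | nil => simp [denPair]
  | append_singleton ω a ih =>
    obtain ⟨h1, h2, h3⟩ := ih fun b hb => h b (by simp [hb])
    have ha : (2 : ℝ) ≤ a := by exact_mod_cast h a (by simp)
    simp only [denPair_concat, List.length_append, List.length_singleton, pow_succ]
    refine ⟨by linarith, by nlinarith, by nlinarith⟩

lemma denPair_pos {ω : List ℕ} (h : ∀ a ∈ ω, 2 ≤ a) : 0 < (denPair ω).1 :=
  lt_of_lt_of_le (by positivity) (denPair_bounds h).2.2

lemma gaussMap_mem {a : ℕ} (ha : 2 ≤ a) {x : ℝ} (hx : x ∈ Ioo (-(1 / 2) : ℝ) 1) :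
    gaussMap a x ∈ Ioo (0 : ℝ) 1 := by
  have ha : (2 : ℝ) ≤ a := by exact_mod_cast ha
  obtain ⟨h1, h2⟩ := hx
  have : 0 < a + x := by linarith
  refine ⟨by unfold gaussMap; positivity, ?_⟩
  rw [gaussMap, div_lt_one this]; linarith

lemma unit_subset : Ioo (0 : ℝ) 1 ⊆ Ioo (-(1 / 2) : ℝ) 1 := Ioo_subset_Ioo_left (by norm_num)

lemma wordMap_mem {ω : List ℕ} (h : ∀ a ∈ ω, 2 ≤ a) {x : ℝ} (hx : x ∈ Ioo (-(1 / 2) : ℝ) 1) :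
    wordMap ω x ∈ Ioo (-(1 / 2) : ℝ) 1 := by
  induction ω with
  | nil => exact hx
  | cons a ω ih =>
    exact unit_subset (gaussMap_mem (h a (by simp)) (ih fun b hb => h b (by simp [hb])))

lemma wordMap_mem_unit {ω : List ℕ} (h : ∀ a ∈ ω, 2 ≤ a) {x : ℝ} (hx : x ∈ Ioo (0 : ℝ) 1) :
    wordMap ω x ∈ Ioo (0 : ℝ) 1 := by
  cases ω with
  | nil => exact hx
  | cons a ω =>
    exact gaussMap_mem (h a (by simp))
      (wordMap_mem (fun b hb => h b (by simp [hb])) (unit_subset hx))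

lemma denom_bounds {ω : List ℕ} (h : ∀ a ∈ ω, 2 ≤ a) {x : ℝ} (hx : x ∈ Ioo (-(1 / 2) : ℝ) 1) :
    (denPair ω).1 / 2 ≤ (denPair ω).1 + (denPair ω).2 * x ∧
      (denPair ω).1 + (denPair ω).2 * x ≤ 2 * (denPair ω).1 := by
  obtain ⟨h1, h2, -⟩ := denPair_bounds h
  have h3 := denPair_pos h
  obtain ⟨hx1, hx2⟩ := hx
  constructor <;> nlinarith

lemma wordMap_sub {ω : List ℕ} (h : ∀ a ∈ ω, 2 ≤ a) {u v : ℝ} (hu : u ∈ Ioo (-(1 / 2) : ℝ) 1)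
    (hv : v ∈ Ioo (-(1 / 2) : ℝ) 1) :
    wordMap ω u - wordMap ω v = (-1) ^ ω.length * (u - v) /
      (((denPair ω).1 + (denPair ω).2 * u) * ((denPair ω).1 + (denPair ω).2 * v)) := by
  induction ω using List.reverseRecOn generalizing u v with
  | nil => simp [denPair, wordMap]
  | append_singleton ω a ih =>
    have hω : ∀ b ∈ ω, 2 ≤ b := fun b hb => h b (by simp [hb])
    have ha : 2 ≤ a := h a (by simp)
    have ha' : (2 : ℝ) ≤ a := by exact_mod_cast ha
    have hau := gaussMap_mem ha hu
    have hav := gaussMap_mem ha hv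
    have e1 := (denom_bounds hω (unit_subset hau)).1
    have e2 := (denom_bounds hω (unit_subset hav)).1
    have e3 := (denom_bounds h hu).1
    have e4 := (denom_bounds h hv).1
    have hq := denPair_pos hω
    have hq' := denPair_pos h
    rw [wordMap_append, wordMap_append]
    simp only [wordMap]
    rw [ih hω (unit_subset hau) (unit_subset hav)]
    rw [denPair_concat] at *
    simp only [List.length_append, List.length_singleton, pow_succ] at *
    have au : 0 < a + u := by linarith [hu.1]
    have av : 0 < a + v := by linarith [hv.1]
    set q := (denPair ω).1
    set p := (denPair ω).2
    have k1 : q + p * gaussMap a u = (a * q + p + q * u) / (a + u) := by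
      unfold gaussMap; field_simp; ring
    have k2 : q + p * gaussMap a v = (a * q + p + q * v) / (a + v) := by
      unfold gaussMap; field_simp; ring
    have n1 : a * q + p + q * u ≠ 0 := by linarith
    have n2 : a * q + p + q * v ≠ 0 := by linarith
    rw [k1, k2, gaussMap, gaussMap]
    field_simp
    ring

lemma abs_wordMap_sub_le {ω : List ℕ} (h : ∀ a ∈ ω, 2 ≤ a) {u v : ℝ} (hu : u ∈ Ico (0 : ℝ) 1)
    (hv : v ∈ Ico (0 : ℝ) 1) : |wordMap ω u - wordMap ω v| ≤ (1 / 4) ^ ω.length := by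
  obtain ⟨h1, h2, h3⟩ := denPair_bounds h
  rw [wordMap_sub h ⟨by linarith [hu.1], hu.2⟩ ⟨by linarith [hv.1], hv.2⟩, abs_div, abs_mul,
    abs_pow, abs_neg, abs_one, one_pow, one_mul]
  set q := (denPair ω).1
  set p := (denPair ω).2
  have hq : (2 : ℝ) ^ ω.length ≤ q + p * u := by nlinarith [mul_nonneg h1 hu.1]
  have hq' : (2 : ℝ) ^ ω.length ≤ q + p * v := by nlinarith [mul_nonneg h1 hv.1]
  have h2 : (0 : ℝ) < 2 ^ ω.length := by positivity
  have e : (1 / 4 : ℝ) ^ ω.length = 1 / (2 ^ ω.length * 2 ^ ω.length) := by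
    rw [← mul_pow, div_pow]; norm_num
  rw [e, abs_of_pos (mul_pos (h2.trans_le hq) (h2.trans_le hq'))]
  have : |u - v| ≤ 1 := by rw [abs_le]; constructor <;> linarith [hu.1, hu.2, hv.1, hv.2]
  have : 0 ≤ q + p * u := h2.le.trans hq
  gcongr

lemma wordMap_injOn {ω : List ℕ} (h : ∀ a ∈ ω, 2 ≤ a) :
    InjOn (wordMap ω) (Ioo (-(1 / 2) : ℝ) 1) := by
  intro u hu v hv huv
  have := wordMap_sub h hu hv
  have e1 := (denom_bounds h hu).1
  have e2 := (denom_bounds h hv).1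
  have hq := denPair_pos h
  rw [huv, sub_self, eq_comm, div_eq_zero_iff, mul_eq_zero] at this
  rcases this with (h0 | h0) | h0
  · exact absurd h0 (pow_ne_zero _ (by norm_num))
  · linarith
  · have : 0 < ((denPair ω).1 + (denPair ω).2 * u) * ((denPair ω).1 + (denPair ω).2 * v) :=
      mul_pos (by linarith) (by linarith)
    linarith

lemma wordMap_measurable (ω : List ℕ) : Measurable (wordMap ω) := by
  induction ω with
  | nil => exact measurable_id
  | cons a ω ih =>
    simp only [wordMap, gaussMap]
    fun_prop

/-- The truncation of a sequence to its first `n` entries. -/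
def pre (s : ℕ → ℕ) (n : ℕ) : List ℕ := List.ofFn fun i : Fin n => s i

lemma pre_succ (s : ℕ → ℕ) (n : ℕ) : pre s (n + 1) = pre s n ++ [s n] := by
  rw [pre, List.ofFn_succ', List.concat_eq_append]
  rfl

lemma pre_succ' (s : ℕ → ℕ) (n : ℕ) : pre s (n + 1) = s 0 :: pre (fun k => s (k + 1)) n := by
  simp [pre, List.ofFn_succ]

lemma pre_mem {s : ℕ → ℕ} {E : Set ℕ} (hs : ∀ k, s k ∈ E) (n : ℕ) : ∀ a ∈ pre s n, a ∈ E := by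
  intro a ha
  simp only [pre, List.mem_ofFn] at ha
  obtain ⟨i, rfl⟩ := ha
  exact hs i

lemma pre_length (s : ℕ → ℕ) (n : ℕ) : (pre s n).length = n := by simp [pre]

lemma tendsto_codingMap {s : ℕ → ℕ} (hs : ∀ k, 2 ≤ s k) :
    Tendsto (fun n => wordMap (pre s n) 0) atTop (𝓝 (codingMap s)) := by
  have hc : CauchySeq fun n => wordMap (pre s n) 0 := by
    refine cauchySeq_of_le_geometric (1 / 4) 1 (by norm_num) fun n => ?_
    rw [one_mul, pre_succ, wordMap_append, Real.dist_eq]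
    have h2 : ∀ a ∈ pre s n, 2 ≤ a := pre_mem (E := {a | 2 ≤ a}) hs n
    have := gaussMap_mem (hs n) (x := 0) (by norm_num)
    simpa [pre_length, wordMap] using abs_wordMap_sub_le h2 (u := 0) (v := gaussMap (s n) 0) (by simp)
      ⟨this.1.le, this.2⟩
  exact hc.tendsto_limUnder

lemma codingMap_mem_Icc {s : ℕ → ℕ} (hs : ∀ k, 2 ≤ s k) : codingMap s ∈ Icc (0 : ℝ) 1 := by
  refine isClosed_Icc.mem_of_tendsto (tendsto_codingMap hs) (Eventually.of_forall fun n => ?_)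
  cases n with
  | zero => simp [pre, wordMap]
  | succ n =>
    rw [pre_succ']
    have h2 := pre_mem (E := {a | 2 ≤ a}) (fun k => hs (k + 1)) n
    exact Ioo_subset_Icc_self (gaussMap_mem (hs 0) (wordMap_mem h2 (by norm_num)))

lemma codingMap_eq {s : ℕ → ℕ} (hs : ∀ k, 2 ≤ s k) :
    codingMap s = gaussMap (s 0) (codingMap fun k => s (k + 1)) := by
  have h1 := (tendsto_codingMap hs).comp (tendsto_add_atTop_nat 1)
  have h2 := tendsto_codingMap (s := fun k => s (k + 1)) fun k => hs (k + 1)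
  have h3 := (codingMap_mem_Icc (s := fun k => s (k + 1)) fun k => hs (k + 1)).1
  have ha : (2 : ℝ) ≤ s 0 := by exact_mod_cast hs 0
  refine tendsto_nhds_unique h1 ?_
  have h4 : (fun n => wordMap (pre s n) 0) ∘ (fun n => n + 1) =
      fun n => 1 / ((s 0 : ℝ) + wordMap (pre (fun k => s (k + 1)) n) 0) := by
    funext n
    simp [pre_succ', wordMap, gaussMap]
  rw [h4]
  exact tendsto_const_nhds.div (tendsto_const_nhds.add h2) (by linarith)

lemma codingMap_mem {s : ℕ → ℕ} (hs : ∀ k, 2 ≤ s k) : codingMap s ∈ Ioc (0 : ℝ) (1 / 2) := by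
  have ha : (2 : ℝ) ≤ s 0 := by exact_mod_cast hs 0
  have h3 := (codingMap_mem_Icc (s := fun k => s (k + 1)) fun k => hs (k + 1)).1
  rw [codingMap_eq hs, gaussMap]
  refine ⟨by positivity, ?_⟩
  apply one_div_le_one_div_of_le <;> linarith

lemma codingMap_eq_wordMap {s : ℕ → ℕ} (hs : ∀ k, 2 ≤ s k) (n : ℕ) :
    codingMap s = wordMap (pre s n) (codingMap fun k => s (k + n)) := by
  induction n with
  | zero => simp [pre, wordMap]
  | succ n ih =>
    rw [ih, pre_succ, wordMap_append, codingMap_eq fun k => hs (k + n)]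
    simp [wordMap, add_comm, add_left_comm]

section LimitSet

variable {E : Set ℕ}

lemma limitSet_subset (hE : ∀ a ∈ E, 2 ≤ a) : limitSet E ⊆ Ioc (0 : ℝ) (1 / 2) := by
  rintro _ ⟨s, hs, rfl⟩
  exact codingMap_mem fun k => hE _ (hs k)

lemma limitSet_subset_unit (hE : ∀ a ∈ E, 2 ≤ a) : limitSet E ⊆ Ioo (0 : ℝ) 1 :=
  (limitSet_subset hE).trans fun _ hx => ⟨hx.1, by linarith [hx.2]⟩

lemma exists_of_mem_limitSet (hE : ∀ a ∈ E, 2 ≤ a) {x : ℝ} (hx : x ∈ limitSet E) :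
    ∃ a ∈ E, ∃ y ∈ limitSet E, x = gaussMap a y := by
  obtain ⟨s, hs, rfl⟩ := hx
  exact ⟨s 0, hs 0, _, ⟨fun k => s (k + 1), fun k => hs _, rfl⟩, codingMap_eq fun k => hE _ (hs k)⟩

lemma mem_limitSet_of_gaussMap (hE : ∀ a ∈ E, 2 ≤ a) {a : ℕ} {z : ℝ}
    (hz : z ∈ Ioo (-(1 / 2) : ℝ) 1) (h : gaussMap a z ∈ limitSet E) : z ∈ limitSet E := by
  obtain ⟨b, hb, w, hw, e⟩ := exists_of_mem_limitSet hE h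
  have hw' := limitSet_subset hE hw
  simp only [gaussMap, one_div, inv_inj] at e
  have h1 : ((a : ℤ) : ℝ) < ((b + 1 : ℤ) : ℝ) := by push_cast; linarith [hz.1, hw'.2]
  have h2 : ((b : ℤ) : ℝ) < ((a + 1 : ℤ) : ℝ) := by push_cast; linarith [hz.2, hw'.1]
  have h3 := Int.cast_lt.1 h1
  have h4 := Int.cast_lt.1 h2
  obtain rfl : a = b := by omega
  obtain rfl : z = w := by linarith
  exact hw

lemma mem_limitSet_of_wordMap (hE : ∀ a ∈ E, 2 ≤ a) {ω : List ℕ} (hω : ∀ a ∈ ω, a ∈ E) {z : ℝ}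
    (hz : z ∈ Ioo (-(1 / 2) : ℝ) 1) (h : wordMap ω z ∈ limitSet E) : z ∈ limitSet E := by
  induction ω with
  | nil => exact h
  | cons a ω ih =>
    have hω' : ∀ b ∈ ω, b ∈ E := fun b hb => hω b (by simp [hb])
    exact ih hω' (mem_limitSet_of_gaussMap hE
      (wordMap_mem (fun b hb => hE b (hω' b hb)) hz) h)

/-- Small balls centred at a point of the limit set pull back to balls of bounded distortion. -/
lemma ball_inter_limitSet_subset (hE : ∀ a ∈ E, 2 ≤ a) {ω : List ℕ} (hω : ∀ a ∈ ω, a ∈ E) {y r : ℝ}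
    (hy : y ∈ limitSet E) (hr : r < 1 / (8 * (denPair ω).1 ^ 2)) :
    closedBall (wordMap ω y) r ∩ limitSet E ⊆
      wordMap ω '' (closedBall y (4 * (denPair ω).1 ^ 2 * r) ∩ Ioo 0 1) := by
  rintro x ⟨hx, hxE⟩
  rw [mem_closedBall, Real.dist_eq] at hx
  have h2 : ∀ a ∈ ω, 2 ≤ a := fun a ha => hE a (hω a ha)
  obtain ⟨hp, hpq, -⟩ := denPair_bounds h2
  have hq := denPair_pos h2
  have hyJ := limitSet_subset hE hy
  have hsub := fun {u} (hu : u ∈ Ioo (-(1 / 2) : ℝ) 1) => wordMap_sub h2 hu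
    (unit_subset (limitSet_subset_unit hE hy))
  have hden := fun {u} (hu : u ∈ Ioo (-(1 / 2) : ℝ) 1) => denom_bounds h2 hu
  set q := (denPair ω).1
  set p := (denPair ω).2
  set ε : ℝ := (-1) ^ ω.length with hε
  have hε2 : ε * ε = 1 := by rw [hε, ← mul_pow]; norm_num
  have hεabs : |ε| = 1 := by rw [hε, abs_pow]; simp
  set d := x - wordMap ω y
  have hQ : q ≤ q + p * y := by nlinarith [mul_nonneg hp hyJ.1.le]
  have hQ' : q + p * y ≤ 3 / 2 * q := by nlinarith [mul_le_mul_of_nonneg_left hyJ.2 hp]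
  set Q := q + p * y with hQdef
  have hdq : |d| * q ^ 2 ≤ 1 / 8 := by
    have : |d| < 1 / (8 * q ^ 2) := lt_of_le_of_lt hx hr
    rw [lt_div_iff₀ (by positivity)] at this
    linarith
  have hD : |ε * d * Q| * q ≤ 3 / 16 := by
    rw [abs_mul, abs_mul, hεabs, one_mul, abs_of_pos (hq.trans_le hQ)]
    nlinarith [mul_le_mul_of_nonneg_left hQ' (mul_nonneg (abs_nonneg d) hq.le)]
  set D := ε * d * Q
  have hDp : |D * p| ≤ 3 / 16 := by
    rw [abs_mul, abs_of_nonneg hp]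
    exact (mul_le_mul_of_nonneg_left hpq (abs_nonneg _)).trans hD
  have hDQ : |D * Q| ≤ 9 / 32 := by
    rw [abs_mul, abs_of_pos (hq.trans_le hQ)]
    nlinarith [mul_le_mul_of_nonneg_left hQ' (abs_nonneg D)]
  have hden1 : 13 / 16 ≤ 1 - D * p := by linarith [(abs_le.1 hDp).2]
  have hne : 1 - D * p ≠ 0 := by linarith
  set w := D * Q / (1 - D * p) with hw
  have hwabs : |w| ≤ 9 / 26 := by
    rw [hw, abs_div, abs_of_pos (a := 1 - D * p) (by linarith), div_le_iff₀ (by linarith)]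
    linarith
  have huJ : y + w ∈ Ioo (-(1 / 2) : ℝ) 1 := by
    constructor <;> linarith [hyJ.1, hyJ.2, (abs_le.1 hwabs).1, (abs_le.1 hwabs).2]
  have hden_u := hden huJ
  have hwD : w = D * (q + p * (y + w)) := by
    rw [hw]; field_simp; rw [hQdef]; ring
  have hmap : wordMap ω (y + w) = x := by
    have := hsub huJ
    have e : ε * (y + w - y) = d * ((q + p * (y + w)) * Q) := by
      have : y + w - y = D * (q + p * (y + w)) := by linarith
      rw [this]
      calc ε * (D * (q + p * (y + w))) = (ε * ε) * (d * ((q + p * (y + w)) * Q)) := by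
            simp only [D]; ring
        _ = _ := by rw [hε2, one_mul]
    rw [e, mul_div_assoc, div_self (mul_pos (by linarith) (by linarith)).ne', mul_one] at this
    linarith
  refine ⟨y + w, ⟨?_, limitSet_subset_unit hE
    (mem_limitSet_of_wordMap hE hω huJ (hmap ▸ hxE))⟩, hmap⟩
  rw [mem_closedBall, Real.dist_eq, add_sub_cancel_left, hwD, abs_mul,
    abs_of_pos (a := q + p * (y + w)) (by linarith)]
  have : |D| = |d| * Q := by
    simp only [D]
    rw [abs_mul, abs_mul, hεabs, one_mul, abs_of_pos (hq.trans_le hQ)]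
  rw [this]
  have h0 := abs_nonneg d
  calc |d| * Q * (q + p * (y + w)) ≤ r * (2 * q) * (2 * q) := by
        have : 0 ≤ r := h0.trans hx
        have : 0 ≤ Q := by linarith
        have : 0 ≤ q + p * (y + w) := by linarith
        gcongr <;> linarith
    _ = _ := by ring

end LimitSet

section Conformal

variable {E : Set ℕ} {δ : ℝ} {μ : Measure ℝ}

lemma IsConformal.ae_mem (hμ : IsConformal E δ μ) : ∀ᵐ x ∂μ, x ∈ limitSet E := hμ.2.1

lemma gaussMap_measurable (a : ℕ) : Measurable (gaussMap a) := by
  unfold gaussMap; fun_prop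

lemma gaussMap_eq (a : ℕ) : gaussMap a = fun x : ℝ => (a + x)⁻¹ := by
  funext x; simp [gaussMap]

lemma gaussMap_injOn {a : ℕ} (ha : 2 ≤ a) : InjOn (gaussMap a) (Ioo (-(1 / 2) : ℝ) 1) := by
  simpa [wordMap] using wordMap_injOn (ω := [a]) (by simpa using ha)

lemma abs_deriv_gaussMap_rpow {a : ℕ} {x : ℝ} (hx : 0 < a + x) :
    |deriv (gaussMap a) x| ^ δ = (a + x) ^ (-(2 * δ)) := by
  have h1 : HasDerivAt (gaussMap a) (-1 / (a + x) ^ 2) x := by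
    have := ((hasDerivAt_id x).const_add (a : ℝ)).fun_inv hx.ne'
    simpa [gaussMap_eq] using this
  rw [h1.deriv, abs_div, abs_neg, abs_one, abs_of_pos (by positivity), one_div,
    ← Real.rpow_natCast, ← Real.rpow_neg hx.le, ← Real.rpow_mul hx.le]
  congr 1; push_cast; ring

lemma measurableSet_wordMap_image {ω : List ℕ} (hω : ∀ a ∈ ω, 2 ≤ a) {A : Set ℝ}
    (hA : A ⊆ Ioo 0 1) (hAm : MeasurableSet A) : MeasurableSet (wordMap ω '' A) :=
  hAm.image_of_measurable_injOn (wordMap_measurable ω)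
    ((wordMap_injOn hω).mono (hA.trans unit_subset))

lemma measure_gaussMap_image (hE : ∀ a ∈ E, 2 ≤ a) (hμ : IsConformal E δ μ) (hδ : 0 < δ) {a : ℕ}
    (ha : a ∈ E) {A : Set ℝ} (hA : A ⊆ Ioo 0 1) (hAm : MeasurableSet A) :
    μ (gaussMap a '' A) = ∫⁻ x in A, ENNReal.ofReal ((a + x) ^ (-(2 * δ))) ∂μ := by
  have := hμ.1
  have ha2 := hE a ha
  have hm : MeasurableSet (gaussMap a '' A) := hAm.image_of_measurable_injOn
    (gaussMap_measurable a) ((gaussMap_injOn ha2).mono (hA.trans unit_subset))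
  have hsub : gaussMap a '' A ⊆ Icc 0 1 := by
    rintro _ ⟨x, hx, rfl⟩
    exact Ioo_subset_Icc_self (gaussMap_mem ha2 (unit_subset (hA hx)))
  have hae : ∀ b ∈ E, ∀ x ∈ limitSet E, gaussMap b x ∈ gaussMap a '' A → b = a ∧ x ∈ A := by
    rintro b hb x hx ⟨z, hz, e⟩
    have hx' := limitSet_subset_unit hE hx
    have hz' := hA hz
    simp only [gaussMap, one_div, inv_inj] at e
    have h1 : ((a : ℤ) : ℝ) < ((b + 1 : ℤ) : ℝ) := by push_cast; linarith [hz'.1, hx'.2]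
    have h2 : ((b : ℤ) : ℝ) < ((a + 1 : ℤ) : ℝ) := by push_cast; linarith [hz'.2, hx'.1]
    have h3 := Int.cast_lt.1 h1
    have h4 := Int.cast_lt.1 h2
    obtain rfl : a = b := by omega
    obtain rfl : z = x := by linarith
    exact ⟨rfl, hz⟩
  rw [hμ.2.2 _ hsub hm, tsum_eq_single (⟨a, ha⟩ : E)]
  · have hset : gaussMap a ⁻¹' (gaussMap a '' A) =ᵐ[μ] A := by
      filter_upwards [hμ.ae_mem] with x hx
      exact propext ⟨fun h => (hae a ha x hx h).2, fun h => ⟨x, h, rfl⟩⟩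
    have hpos : ∀ x ∈ A, 1 ≤ (a : ℝ) + x := fun x hx => by
      have : (2 : ℝ) ≤ a := by exact_mod_cast ha2
      linarith [(hA hx).1]
    rw [setIntegral_congr_set hset, setIntegral_congr_fun hAm (fun x hx =>
      abs_deriv_gaussMap_rpow (δ := δ) (lt_of_lt_of_le one_pos (hpos x hx))),
      ofReal_integral_eq_lintegral_ofReal]
    · refine Integrable.of_bound (C := 1) (Measurable.aestronglyMeasurable (by fun_prop)) ?_
      filter_upwards [ae_restrict_mem hAm] with x hx
      have := hpos x hx
      rw [Real.norm_of_nonneg (by positivity)]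
      exact Real.rpow_le_one_of_one_le_of_nonpos this (by linarith)
    · filter_upwards [ae_restrict_mem hAm] with x hx
      have := hpos x hx
      simp only [Pi.zero_apply]
      positivity
  · rintro ⟨b, hb⟩ hne
    have hzero : μ (gaussMap b ⁻¹' (gaussMap a '' A)) = 0 := by
      rw [measure_eq_zero_iff_ae_notMem]
      filter_upwards [hμ.ae_mem] with x hx h
      exact hne (Subtype.ext (hae b hb x hx h).1)
    simp [Measure.restrict_eq_zero.2 hzero]

lemma lintegral_gaussMap_image (hE : ∀ a ∈ E, 2 ≤ a) (hμ : IsConformal E δ μ) (hδ : 0 < δ) {a : ℕ}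
    (ha : a ∈ E) {A : Set ℝ} (hA : A ⊆ Ioo 0 1) (hAm : MeasurableSet A) {f : ℝ → ℝ≥0∞}
    (hf : Measurable f) :
    ∫⁻ x in gaussMap a '' A, f x ∂μ =
      ∫⁻ x in A, ENNReal.ofReal ((a + x) ^ (-(2 * δ))) * f (gaussMap a x) ∂μ := by
  have hg := gaussMap_measurable a
  have hw : Measurable fun x : ℝ => ENNReal.ofReal ((a + x) ^ (-(2 * δ))) := by fun_prop
  have key : μ.restrict (gaussMap a '' A) =
      ((μ.restrict A).withDensity fun x => ENNReal.ofReal ((a + x) ^ (-(2 * δ)))).map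
        (gaussMap a) := by
    ext S hS
    rw [Measure.restrict_apply hS, Measure.map_apply hg hS, withDensity_apply _ (hg hS),
      Measure.restrict_restrict (hg hS), inter_comm S, ← image_inter_preimage, inter_comm A,
      measure_gaussMap_image hE hμ hδ ha (inter_subset_right.trans hA) ((hg hS).inter hAm)]
  rw [key, lintegral_map hf hg]
  exact lintegral_withDensity_eq_lintegral_mul _ hw (hf.comp hg)

lemma measure_wordMap_image (hE : ∀ a ∈ E, 2 ≤ a) (hμ : IsConformal E δ μ) (hδ : 0 < δ)
    {ω : List ℕ} (hω : ∀ a ∈ ω, a ∈ E) {A : Set ℝ} (hA : A ⊆ Ioo 0 1) (hAm : MeasurableSet A) :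
    μ (wordMap ω '' A) =
      ∫⁻ x in A, ENNReal.ofReal (((denPair ω).1 + (denPair ω).2 * x) ^ (-(2 * δ))) ∂μ := by
  induction ω using List.reverseRecOn generalizing A with
  | nil => simp [denPair, wordMap]
  | append_singleton ω a ih =>
    have hω' : ∀ b ∈ ω, b ∈ E := fun b hb => hω b (by simp [hb])
    have ha : a ∈ E := hω a (by simp)
    have h2 : ∀ b ∈ ω, 2 ≤ b := fun b hb => hE b (hω' b hb)
    have him : wordMap (ω ++ [a]) '' A = wordMap ω '' (gaussMap a '' A) := by
      rw [image_image]
      exact image_congr fun x _ => by rw [wordMap_append]; rfl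
    have hsub : gaussMap a '' A ⊆ Ioo 0 1 := by
      rintro _ ⟨x, hx, rfl⟩
      exact gaussMap_mem (hE a ha) (unit_subset (hA hx))
    have hm : MeasurableSet (gaussMap a '' A) := hAm.image_of_measurable_injOn
      (gaussMap_measurable a) ((gaussMap_injOn (hE a ha)).mono (hA.trans unit_subset))
    rw [him, ih hω' hsub hm, lintegral_gaussMap_image hE hμ hδ ha hA hAm (by fun_prop)]
    refine setLIntegral_congr_fun hAm fun x hx => ?_
    have hx' := hA hx
    have hden := (denom_bounds h2 (unit_subset (hsub ⟨x, hx, rfl⟩))).1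
    have hq := denPair_pos h2
    have ha2 : (2 : ℝ) ≤ a := by exact_mod_cast hE a ha
    have hax : 0 < a + x := by linarith [hx'.1]
    simp only [denPair_concat]
    rw [← ENNReal.ofReal_mul (by positivity), ← Real.mul_rpow hax.le (by linarith)]
    congr 2
    unfold gaussMap
    field_simp
    ring

lemma measure_wordMap_image_le (hE : ∀ a ∈ E, 2 ≤ a) (hμ : IsConformal E δ μ) (hδ : 0 < δ)
    {ω : List ℕ} (hω : ∀ a ∈ ω, a ∈ E) {A : Set ℝ} (hA : A ⊆ Ioo 0 1) (hAm : MeasurableSet A) :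
    μ (wordMap ω '' A) ≤ ENNReal.ofReal ((denPair ω).1 ^ (-(2 * δ))) * μ A := by
  have h2 : ∀ b ∈ ω, 2 ≤ b := fun b hb => hE b (hω b hb)
  rw [measure_wordMap_image hE hμ hδ hω hA hAm, ← setLIntegral_const]
  refine setLIntegral_mono' hAm fun x hx => ENNReal.ofReal_le_ofReal ?_
  refine Real.rpow_le_rpow_of_nonpos (denPair_pos h2) ?_ (by linarith)
  nlinarith [mul_nonneg (denPair_bounds h2).1 (hA hx).1.le]

lemma measure_unit (hE : ∀ a ∈ E, 2 ≤ a) (hμ : IsConformal E δ μ) : μ (Ioo 0 1) = 1 := by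
  have := hμ.1
  rw [← measure_univ (μ := μ)]
  refine measure_congr ?_
  filter_upwards [hμ.ae_mem] with x hx
  exact propext ⟨fun _ => trivial, fun _ => limitSet_subset_unit hE hx⟩

lemma measure_wordMap_image_le_mul (hE : ∀ a ∈ E, 2 ≤ a) (hμ : IsConformal E δ μ) (hδ : 0 < δ)
    {ω : List ℕ} (hω : ∀ a ∈ ω, a ∈ E) {A : Set ℝ} (hA : A ⊆ Ioo 0 1) (hAm : MeasurableSet A) :
    μ (wordMap ω '' A) ≤
      ENNReal.ofReal (2 ^ (2 * δ)) * μ A * μ (wordMap ω '' Ioo 0 1) := by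
  have h2 : ∀ b ∈ ω, 2 ≤ b := fun b hb => hE b (hω b hb)
  have hq := denPair_pos h2
  have hlow : ENNReal.ofReal ((2 * (denPair ω).1) ^ (-(2 * δ))) ≤ μ (wordMap ω '' Ioo 0 1) := by
    rw [measure_wordMap_image hE hμ hδ hω subset_rfl measurableSet_Ioo,
      ← mul_one (ENNReal.ofReal _), ← measure_unit hE hμ, ← setLIntegral_const]
    refine setLIntegral_mono' measurableSet_Ioo fun x hx => ENNReal.ofReal_le_ofReal ?_
    obtain ⟨h3, h4⟩ := denom_bounds h2 (unit_subset hx)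
    exact Real.rpow_le_rpow_of_nonpos (by linarith) h4 (by linarith)
  refine (measure_wordMap_image_le hE hμ hδ hω hA hAm).trans ?_
  have e : (denPair ω).1 ^ (-(2 * δ)) =
      2 ^ (2 * δ) * (2 * (denPair ω).1) ^ (-(2 * δ)) := by
    rw [Real.mul_rpow (by norm_num) hq.le, ← mul_assoc, ← Real.rpow_add (by norm_num)]
    simp
  rw [e, ENNReal.ofReal_mul (by positivity), mul_assoc, mul_assoc, mul_comm (μ A)]
  gcongr

lemma wordMap_image_disjoint {ω η : List ℕ} (hω : ∀ a ∈ ω, 2 ≤ a) (hη : ∀ a ∈ η, 2 ≤ a)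
    (hlen : ω.length = η.length) {u v : ℝ} (hu : u ∈ Ioo (0 : ℝ) 1) (hv : v ∈ Ioo (0 : ℝ) 1)
    (h : wordMap ω u = wordMap η v) : ω = η := by
  induction ω generalizing η with
  | nil => simpa [eq_comm] using hlen
  | cons a ω ih =>
    cases η with
    | nil => simp at hlen
    | cons b η =>
      have hω' : ∀ b ∈ ω, 2 ≤ b := fun c hc => hω c (by simp [hc])
      have hη' : ∀ b ∈ η, 2 ≤ b := fun c hc => hη c (by simp [hc])
      have hx := wordMap_mem_unit hω' hu
      have hz := wordMap_mem_unit hη' hv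
      simp only [wordMap, gaussMap, one_div, inv_inj] at h
      have h1 : ((a : ℤ) : ℝ) < ((b + 1 : ℤ) : ℝ) := by push_cast; linarith [hz.2, hx.1]
      have h2 : ((b : ℤ) : ℝ) < ((a + 1 : ℤ) : ℝ) := by push_cast; linarith [hz.1, hx.2]
      have h3 := Int.cast_lt.1 h1
      have h4 := Int.cast_lt.1 h2
      obtain rfl : a = b := by omega
      rw [ih hω' hη' (by simpa using hlen) (by linarith)]

/-- The measure of the set of points whose `n`-th tail lies in `A`, up to bounded distortion. -/
lemma measure_iUnion_wordMap_image_le (hE : ∀ a ∈ E, 2 ≤ a) (hμ : IsConformal E δ μ) (hδ : 0 < δ)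
    (n : ℕ) {A : Set ℝ} (hA : A ⊆ Ioo 0 1) (hAm : MeasurableSet A) :
    μ (⋃ ω : {ω : List ℕ // (∀ a ∈ ω, a ∈ E) ∧ ω.length = n}, wordMap ω '' A) ≤
      ENNReal.ofReal (2 ^ (2 * δ)) * μ A := by
  have := hμ.1
  refine (measure_iUnion_le _).trans ?_
  refine (ENNReal.tsum_le_tsum fun ω =>
    measure_wordMap_image_le_mul hE hμ hδ ω.2.1 hA hAm).trans ?_
  rw [ENNReal.tsum_mul_left]
  refine mul_le_of_le_one_right' ?_
  rw [← measure_iUnion]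
  · exact prob_le_one
  · rintro ω η hne
    rw [Function.onFun, Set.disjoint_left]
    rintro _ ⟨u, hu, rfl⟩ ⟨v, hv, e⟩
    exact hne (Subtype.ext (wordMap_image_disjoint (fun a ha => hE a (ω.2.1 a ha))
      (fun a ha => hE a (η.2.1 a ha)) (ω.2.2.trans η.2.2.symm) hu hv e.symm))
  · exact fun ω => measurableSet_wordMap_image (fun a ha => hE a (ω.2.1 a ha)) subset_rfl
      measurableSet_Ioo

lemma measure_gaussMap_unit_le (hE : ∀ a ∈ E, 2 ≤ a) (hμ : IsConformal E δ μ) (hδ : 0 < δ) {a : ℕ}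
    (ha : a ∈ E) : μ (gaussMap a '' Ioo 0 1) ≤ ENNReal.ofReal ((a : ℝ) ^ (-(2 * δ))) := by
  have := measure_wordMap_image_le hE hμ hδ (ω := [a]) (by simpa using ha) subset_rfl
    measurableSet_Ioo
  simpa [measure_unit hE hμ, wordMap, denPair] using this

lemma measure_Ioo_le (hE : ∀ a ∈ E, 2 ≤ a) (hμ : IsConformal E δ μ) (hδ : 0 < δ) {τ : ℝ}
    (hτ : 0 < τ) (hτδ : τ < 2 * δ - 1) :
    ∃ C : ℝ, 0 < C ∧ ∀ t : ℝ, 0 < t → μ (Iio t) ≤ ENNReal.ofReal (C * t ^ τ) := by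
  have hsum : Summable fun b : ℕ => (b : ℝ) ^ (-(2 * δ - τ)) :=
    Real.summable_nat_rpow.2 (by linarith)
  have hS : 0 < ∑' b : ℕ, (b : ℝ) ^ (-(2 * δ - τ)) :=
    hsum.tsum_pos (fun b => by positivity) 1 (by simp)
  refine ⟨(∑' b : ℕ, (b : ℝ) ^ (-(2 * δ - τ))) * 2 ^ τ, by positivity, fun t ht => ?_⟩
  have hcov : Iio t ≤ᵐ[μ] ⋃ b ∈ {b ∈ E | 1 / t < (b : ℝ) + 1}, gaussMap b '' Ioo 0 1 := by
    filter_upwards [hμ.ae_mem] with x hx hxt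
    obtain ⟨b, hb, y, hy, rfl⟩ := exists_of_mem_limitSet hE hx
    have hy' := limitSet_subset_unit hE hy
    refine mem_biUnion ⟨hb, ?_⟩ ⟨y, hy', rfl⟩
    have hxt : gaussMap b y < t := hxt
    have : 0 < (b : ℝ) + y := by have := hy'.1; positivity
    rw [gaussMap, div_lt_comm₀ this ht] at hxt
    linarith [hy'.2]
  refine (measure_mono_ae hcov).trans ((measure_biUnion_le _ (to_countable _) _).trans ?_)
  calc ∑' b : {b ∈ E | 1 / t < (b : ℝ) + 1}, μ (gaussMap b '' Ioo 0 1)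
      ≤ ∑' b : {b ∈ E | 1 / t < (b : ℝ) + 1},
          ENNReal.ofReal (((b : ℕ) : ℝ) ^ (-(2 * δ - τ)) * (2 * t) ^ τ) := by
        refine ENNReal.tsum_le_tsum fun ⟨b, hb, hbt⟩ => ?_
        refine (measure_gaussMap_unit_le hE hμ hδ hb).trans (ENNReal.ofReal_le_ofReal ?_)
        have hb2 : (2 : ℝ) ≤ b := by exact_mod_cast hE b hb
        have hb0 : (0 : ℝ) < b := by linarith
        have e : -(2 * δ) = -(2 * δ - τ) + -τ := by ring
        rw [e, Real.rpow_add hb0]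
        gcongr
        rw [Real.rpow_neg hb0.le, ← Real.inv_rpow hb0.le]
        refine Real.rpow_le_rpow (by positivity) ?_ hτ.le
        rw [div_lt_iff₀ ht] at hbt
        rw [inv_le_iff_one_le_mul₀ hb0]
        nlinarith
    _ ≤ ∑' b : ℕ, ENNReal.ofReal ((b : ℝ) ^ (-(2 * δ - τ)) * (2 * t) ^ τ) :=
        ENNReal.tsum_comp_le_tsum_of_injective Subtype.val_injective _
    _ = ENNReal.ofReal ((∑' b : ℕ, (b : ℝ) ^ (-(2 * δ - τ))) * 2 ^ τ * t ^ τ) := by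
        rw [← ENNReal.ofReal_tsum_of_nonneg (fun b => by positivity) (hsum.mul_right _),
          tsum_mul_right, Real.mul_rpow (by norm_num) ht.le, mul_assoc]

/-- Mass of balls at scales between the first-level cylinder and the whole limit set. -/
lemma measure_closedBall_le (hE : ∀ a ∈ E, 2 ≤ a) (hμ : IsConformal E δ μ) (hδ1 : δ < 1)
    {τ : ℝ} (hτ : 0 < τ) (hτδ : τ < 2 * δ - 1) :
    ∃ C : ℝ, 0 < C ∧ ∀ y ∈ limitSet E, ∀ ρ : ℝ, y ^ 2 / 8 ≤ ρ →
      μ (closedBall y ρ) ≤ ENNReal.ofReal (C * ρ ^ δ * y ^ (-(δ - τ))) := by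
  obtain ⟨C, hC, hCt⟩ := measure_Ioo_le hE hμ (by linarith) hτ hτδ
  classical
  refine ⟨C * 6 ^ τ * 4 ^ (δ - τ) + 76, by positivity, fun y hy ρ hρ => ?_⟩
  obtain ⟨hy0, hy1⟩ := limitSet_subset hE hy
  have hρ0 : 0 < ρ := lt_of_lt_of_le (by positivity) hρ
  rcases le_or_gt (y / 4) ρ with hρy | hρy
  · have hsub : closedBall y ρ ⊆ Iio (6 * ρ) := by
      intro x hx
      rw [mem_closedBall, Real.dist_eq, abs_le] at hx
      simp only [mem_Iio]; linarith
    refine (measure_mono hsub).trans ((hCt _ (by positivity)).trans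
      (ENNReal.ofReal_le_ofReal ?_))
    have e : ρ ^ τ = ρ ^ δ * ρ ^ (-(δ - τ)) := by rw [← Real.rpow_add hρ0]; congr 1; ring
    have h1 : ρ ^ (-(δ - τ)) ≤ 4 ^ (δ - τ) * y ^ (-(δ - τ)) := by
      refine (Real.rpow_le_rpow_of_nonpos (by positivity) hρy (by linarith)).trans_eq ?_
      rw [Real.div_rpow hy0.le (by norm_num), Real.rpow_neg (by norm_num : (0 : ℝ) ≤ 4),
        div_inv_eq_mul, mul_comm]
    rw [Real.mul_rpow (by norm_num) hρ0.le, e]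
    calc C * (6 ^ τ * (ρ ^ δ * ρ ^ (-(δ - τ))))
        ≤ C * (6 ^ τ * (ρ ^ δ * (4 ^ (δ - τ) * y ^ (-(δ - τ))))) := by gcongr
      _ = (C * 6 ^ τ * 4 ^ (δ - τ)) * ρ ^ δ * y ^ (-(δ - τ)) := by ring
      _ ≤ _ := by gcongr; linarith
  · set L : ℝ := 1 / (y + ρ) - 1 with hL
    set U : ℝ := 1 / (y - ρ) with hU
    have hyρ : 0 < y - ρ := by linarith
    have hcov : closedBall y ρ ≤ᵐ[μ]
        ⋃ b ∈ (Finset.Icc ⌈L⌉₊ ⌊U⌋₊).filter (· ∈ E), gaussMap b '' Ioo 0 1 := by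
      filter_upwards [hμ.ae_mem] with x hx hxy
      have hxy : x ∈ closedBall y ρ := hxy
      obtain ⟨b, hb, w, hw, rfl⟩ := exists_of_mem_limitSet hE hx
      have hw' := limitSet_subset_unit hE hw
      have hbw : 0 < (b : ℝ) + w := by have := hw'.1; positivity
      rw [mem_closedBall, Real.dist_eq, abs_le, gaussMap] at hxy
      have h1 : 1 / (y + ρ) ≤ b + w := by
        rw [div_le_comm₀ (by linarith) hbw]; linarith
      have h2 : b + w ≤ 1 / (y - ρ) := by
        rw [le_div_comm₀ hbw hyρ]; linarith
      refine mem_biUnion (x := b) ?_ ⟨w, hw', rfl⟩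
      simp only [Finset.coe_filter, Finset.mem_Icc, mem_ofPred_eq]
      exact ⟨⟨Nat.ceil_le.2 (by linarith [hw'.2]), Nat.le_floor (by linarith [hw'.1])⟩, hb⟩
    have hyy : y ^ 2 * (15 / 16) ≤ (y + ρ) * (y - ρ) := by nlinarith
    have hUL : U - L ≤ 1 + 32 / 15 * (ρ / y ^ 2) := by
      have e : U - L = 1 + 2 * ρ / ((y + ρ) * (y - ρ)) := by
        have : 0 < y + ρ := by linarith
        rw [hU, hL]; field_simp; ring
      have e' : 32 / 15 * (ρ / y ^ 2) = 2 * ρ / (y ^ 2 * (15 / 16)) := by field_simp; norm_num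
      rw [e, e']
      gcongr
    have hρy2 : 1 ≤ 8 * (ρ / y ^ 2) := by
      rw [mul_div_assoc', le_div_iff₀ (by positivity)]; linarith
    have hY : 2 ≤ 1 / y := by rw [le_div_iff₀ hy0]; linarith
    have hLY : 4 / 5 * (1 / y) ≤ L + 1 := by
      rw [hL, sub_add_cancel, mul_one_div, div_le_div_iff₀ hy0 (by linarith)]; linarith
    have hyU : (1 : ℝ) / y ≤ U := one_div_le_one_div_of_le hyρ (by linarith)
    have hLy : L ≤ 1 / y := by
      have : 1 / (y + ρ) ≤ 1 / y := one_div_le_one_div_of_le hy0 (by linarith)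
      linarith
    have hcard : (((Finset.Icc ⌈L⌉₊ ⌊U⌋₊).filter (· ∈ E)).card : ℝ) ≤ 19 * (ρ / y ^ 2) := by
      have h1 : (((Finset.Icc ⌈L⌉₊ ⌊U⌋₊).filter (· ∈ E)).card : ℝ) ≤
          ((⌊U⌋₊ + 1 - ⌈L⌉₊ : ℕ) : ℝ) := by
        rw [← Nat.card_Icc]
        exact_mod_cast Finset.card_filter_le _ _
      have h2 : ((⌊U⌋₊ + 1 - ⌈L⌉₊ : ℕ) : ℝ) ≤ U + 1 - L := by
        rcases le_total ⌈L⌉₊ (⌊U⌋₊ + 1) with h | h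
        · rw [Nat.cast_sub h]
          push_cast
          linarith [Nat.le_ceil L, Nat.floor_le (show 0 ≤ U by linarith)]
        · rw [Nat.sub_eq_zero_of_le h]
          push_cast
          linarith
      linarith
    have hterm : ∀ b ∈ (Finset.Icc ⌈L⌉₊ ⌊U⌋₊).filter (· ∈ E),
        μ (gaussMap b '' Ioo 0 1) ≤ ENNReal.ofReal (4 * y ^ (2 * δ)) := by
      intro b hb
      rw [Finset.mem_filter, Finset.mem_Icc] at hb
      have hb2 : (2 : ℝ) ≤ b := by exact_mod_cast hE b hb.2
      have hbL : L ≤ b := (Nat.le_ceil L).trans (by exact_mod_cast hb.1.1)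
      refine (measure_gaussMap_unit_le hE hμ (by linarith) hb.2).trans
        (ENNReal.ofReal_le_ofReal ?_)
      have h3 : (2 * y)⁻¹ ≤ b := by
        have : (2 * y)⁻¹ = 1 / 2 * (1 / y) := by field_simp
        rw [this]; linarith
      refine (Real.rpow_le_rpow_of_nonpos (by positivity) h3 (by linarith)).trans ?_
      rw [Real.inv_rpow (by positivity), ← Real.rpow_neg (by positivity), neg_neg,
        Real.mul_rpow (by norm_num) hy0.le]
      gcongr
      have : (2 : ℝ) ^ (2 * δ) ≤ 2 ^ (2 : ℝ) :=
        Real.rpow_le_rpow_of_exponent_le (by norm_num) (by linarith)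
      exact this.trans (by norm_num)
    refine (measure_mono_ae hcov).trans ((measure_biUnion_finset_le _ _).trans
      ((Finset.sum_le_card_nsmul _ _ _ hterm).trans ?_))
    rw [nsmul_eq_mul, ← ENNReal.ofReal_natCast, ← ENNReal.ofReal_mul (by positivity)]
    refine ENNReal.ofReal_le_ofReal ?_
    have h4 : ρ / y ^ 2 * y ^ (2 * δ) ≤ ρ ^ δ * y ^ (-(δ - τ)) := by
      have e1 : ρ = ρ ^ δ * ρ ^ (1 - δ) := by rw [← Real.rpow_add hρ0]; simp
      have e2 : ρ ^ (1 - δ) ≤ y ^ (1 - δ) :=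
        Real.rpow_le_rpow hρ0.le (by linarith) (by linarith)
      have e3 : y ^ (1 - δ) * y ^ (2 * δ) / y ^ 2 = y ^ (δ - 1) := by
        rw [← Real.rpow_natCast, ← Real.rpow_add hy0, ← Real.rpow_sub hy0]
        congr 1; push_cast; ring
      have e4 : y ^ (δ - 1) ≤ y ^ (-(δ - τ)) :=
        Real.rpow_le_rpow_of_exponent_ge hy0 (by linarith) (by linarith)
      calc ρ / y ^ 2 * y ^ (2 * δ) = ρ ^ δ * (ρ ^ (1 - δ) * y ^ (2 * δ) / y ^ 2) := by
            nth_rewrite 1 [e1]; ring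
        _ ≤ ρ ^ δ * (y ^ (1 - δ) * y ^ (2 * δ) / y ^ 2) := by gcongr
        _ ≤ _ := by rw [e3]; gcongr
    calc _ ≤ 19 * (ρ / y ^ 2) * (4 * y ^ (2 * δ)) := by gcongr
      _ = 76 * (ρ / y ^ 2 * y ^ (2 * δ)) := by ring
      _ ≤ 76 * (ρ ^ δ * y ^ (-(δ - τ))) := by gcongr
      _ = 76 * ρ ^ δ * y ^ (-(δ - τ)) := by ring
      _ ≤ _ := by
        gcongr
        have : 0 ≤ C * 6 ^ τ * 4 ^ (δ - τ) := by positivity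
        linarith

end Conformal

/-- Mass distribution principle for the Hausdorff measure `H^ψ`. -/
lemma one_le_mul_hausdorffPsi {μ : Measure ℝ} [IsProbabilityMeasure μ] {ψ : ℝ → ℝ} {α : ℝ}
    (hα : 0 < α) (hψ : Tendsto ψ (𝓝[>] (0 : ℝ)) (𝓝 0))
    (h : ∀ᵐ x ∂μ, ∀ᶠ r in 𝓝[>] (0 : ℝ), μ (closedBall x r) ≤ ENNReal.ofReal (α * ψ r))
    {A : Set ℝ} (hA : μ Aᶜ = 0) : 1 ≤ ENNReal.ofReal α * hausdorffPsi ψ A := by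
  have hα0 : ENNReal.ofReal α ≠ 0 := by simpa using hα
  set G : ℕ → Set ℝ := fun n =>
    {x | ∀ r : ℝ, 0 < r → r < 1 / (n + 1) → μ (closedBall x r) ≤ ENNReal.ofReal (α * ψ r)} with hG
  have hmono : Monotone fun n => A ∩ G n := by
    intro m n hmn x hx
    refine ⟨hx.1, fun r hr0 hr => hx.2 r hr0 (hr.trans_le ?_)⟩
    have : (m : ℝ) ≤ n := by exact_mod_cast hmn
    gcongr
  have hfull : μ (⋃ n, A ∩ G n) = 1 := by
    rw [← measure_univ (μ := μ)]
    refine measure_congr ?_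
    have hA' : ∀ᵐ x ∂μ, x ∈ A := hA
    filter_upwards [h, hA'] with x hx hxA
    refine propext ⟨fun _ => trivial, fun _ => ?_⟩
    obtain ⟨ε, hε, hr⟩ := mem_nhdsGT_iff_exists_Ioo_subset.1 hx
    obtain ⟨n, hn⟩ := exists_nat_one_div_lt (show (0 : ℝ) < ε from hε)
    exact mem_iUnion.2 ⟨n, hxA, fun r hr0 hrn => hr ⟨hr0, hrn.trans hn⟩⟩
  rw [← hfull, hmono.measure_iUnion]
  refine iSup_le fun n => ?_
  have hatom : ∀ x ∈ G n, μ {x} = 0 := by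
    intro x hx
    have h1 : Tendsto (fun r => ENNReal.ofReal (α * ψ r)) (𝓝[>] (0 : ℝ)) (𝓝 0) := by
      simpa using ENNReal.tendsto_ofReal (hψ.const_mul α)
    refine le_antisymm (ge_of_tendsto h1 ?_) zero_le
    filter_upwards [Ioo_mem_nhdsGT (show (0 : ℝ) < 1 / (n + 1) by positivity)] with r hr
    refine (measure_mono ?_).trans (hx r hr.1 hr.2)
    simpa using hr.1.le
  rw [mul_comm, ← ENNReal.div_le_iff_le_mul (Or.inl hα0) (Or.inl ENNReal.ofReal_ne_top),
    hausdorffPsi, Measure.mkMetric_apply]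
  refine le_iSup₂_of_le (ENNReal.ofReal (1 / (n + 2))) (by rw [ENNReal.ofReal_pos]; positivity) ?_
  refine le_iInf₂ fun t ht => le_iInf fun hd => ?_
  rw [ENNReal.div_le_iff_le_mul (Or.inl hα0) (Or.inl ENNReal.ofReal_ne_top), mul_comm,
    ← ENNReal.tsum_mul_left]
  have hcov : A ∩ G n ⊆ ⋃ k, t k ∩ G n := fun x hx => by
    obtain ⟨k, hk⟩ := mem_iUnion.1 (ht hx.1)
    exact mem_iUnion.2 ⟨k, hk, hx.2⟩
  refine (measure_mono hcov).trans ((measure_iUnion_le _).trans (ENNReal.tsum_le_tsum fun k => ?_))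
  rcases (t k ∩ G n).eq_empty_or_nonempty with he | ⟨x, hxt, hxG⟩
  · simp [he]
  rw [iSup_pos ⟨x, hxt⟩]
  have hdt : ediam (t k) ≠ ⊤ := ne_top_of_le_ne_top ENNReal.ofReal_ne_top (hd k)
  have hsub : t k ⊆ closedBall x (ediam (t k)).toReal := fun z hz => by
    rw [mem_closedBall, dist_edist]
    exact ENNReal.toReal_mono hdt (edist_le_ediam_of_mem hz hxt)
  split_ifs with h0
  · have : t k ∩ G n ⊆ {x} := fun z hz => by simpa [h0] using hsub hz.1
    simpa using (measure_mono this).trans_eq (hatom x hxG)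
  · refine (measure_mono (inter_subset_left.trans hsub)).trans ((hxG _ ?_ ?_).trans_eq ?_)
    · exact ENNReal.toReal_pos h0 hdt
    · refine (ENNReal.toReal_le_of_le_ofReal (by positivity) (hd k)).trans_lt ?_
      gcongr
      linarith
    · rw [ENNReal.ofReal_mul hα.le]

lemma tendsto_log_one_div : Tendsto (fun r : ℝ => Real.log (1 / r)) (𝓝[>] (0 : ℝ)) atTop := by
  simp only [one_div]
  exact Real.tendsto_log_atTop.comp tendsto_inv_nhdsGT_zero

lemma tendsto_rpow_mul_log {δ s : ℝ} (hδ : 0 < δ) (hs : 0 < s) :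
    Tendsto (fun r : ℝ => r ^ δ * Real.log (1 / r) ^ s) (𝓝[>] (0 : ℝ)) (𝓝 0) := by
  have h1 := tendsto_log_mul_rpow_nhdsGT_zero (r := δ / s) (by positivity)
  have h2 : Tendsto (fun r : ℝ => (-(Real.log r * r ^ (δ / s))) ^ s) (𝓝[>] (0 : ℝ)) (𝓝 0) := by
    have := h1.neg.rpow_const (p := s) (Or.inr hs.le)
    simpa [hs.ne'] using this
  refine h2.congr' ?_
  filter_upwards [Ioo_mem_nhdsGT (show (0 : ℝ) < 1 by norm_num)] with r hr
  have hlog : 0 ≤ -Real.log r := by linarith [Real.log_neg hr.1 hr.2]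
  rw [one_div, Real.log_inv, ← neg_mul, Real.mul_rpow hlog (Real.rpow_nonneg hr.1.le _),
    ← Real.rpow_mul hr.1.le, div_mul_cancel₀ _ hs.ne', mul_comm]

section Density

variable {E : Set ℕ} {δ : ℝ} {μ : Measure ℝ}

lemma ae_eventually_tail_ge (hE : ∀ a ∈ E, 2 ≤ a) (hμ : IsConformal E δ μ) (hδ : 0 < δ)
    {τ κ : ℝ} (hτ : 0 < τ) (hτδ : τ < 2 * δ - 1) (hκ : 1 < κ * τ) :
    ∀ᵐ x ∂μ, ∃ s : ℕ → ℕ, (∀ n, s n ∈ E) ∧ x = codingMap s ∧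
      ∀ᶠ n : ℕ in atTop, ((n : ℝ) + 1) ^ (-κ) ≤ codingMap fun k => s (k + n) := by
  obtain ⟨C, hC, hCt⟩ := measure_Ioo_le hE hμ hδ hτ hτδ
  have hκ0 : 0 < κ := by
    by_contra hneg
    nlinarith [mul_nonneg (neg_nonneg.2 (not_lt.1 hneg)) hτ.le]
  have hsub : ∀ n : ℕ, Ioo 0 (((n : ℝ) + 1) ^ (-κ)) ⊆ Ioo 0 1 := fun n =>
    Ioo_subset_Ioo_right (Real.rpow_le_one_of_one_le_of_nonpos (by simp) (by linarith))
  have hsummable : Summable fun n : ℕ => 2 ^ (2 * δ) * (C * ((n : ℝ) + 1) ^ (-(κ * τ))) := by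
    refine (Summable.mul_left _ ?_).mul_left _
    have := (summable_nat_add_iff 1).2 (Real.summable_nat_rpow.2 (neg_lt_neg hκ))
    simpa using this
  have hsum : ∑' n : ℕ, μ (⋃ ω : {ω : List ℕ // (∀ a ∈ ω, a ∈ E) ∧ ω.length = n},
      wordMap ω '' Ioo 0 (((n : ℝ) + 1) ^ (-κ))) ≠ ⊤ := by
    refine ne_top_of_le_ne_top hsummable.tsum_ofReal_ne_top (ENNReal.tsum_le_tsum fun n => ?_)
    refine (measure_iUnion_wordMap_image_le hE hμ hδ n (hsub n) measurableSet_Ioo).trans ?_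
    rw [ENNReal.ofReal_mul (by positivity)]
    gcongr
    refine (measure_mono Ioo_subset_Iio_self).trans ((hCt _ (by positivity)).trans_eq ?_)
    rw [← Real.rpow_mul (by positivity), neg_mul]
  filter_upwards [hμ.ae_mem, ae_eventually_notMem hsum] with x hx hB
  obtain ⟨s, hs, rfl⟩ := hx
  refine ⟨s, hs, rfl, hB.mono fun n hn => ?_⟩
  by_contra! hlt
  refine hn (mem_iUnion.2 ⟨⟨pre s n, pre_mem hs n, pre_length s n⟩, codingMap fun k => s (k + n),
    ⟨(codingMap_mem fun k => hE _ (hs _)).1, hlt⟩, ?_⟩)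
  exact (codingMap_eq_wordMap (fun k => hE _ (hs k)) n).symm

lemma exists_scale {s : ℕ → ℕ} (hs : ∀ k, 2 ≤ s k) {N : ℕ} {r : ℝ} (hr : 0 < r)
    (hrN : r < 1 / (8 * (denPair (pre s N)).1 ^ 2)) :
    ∃ n ≥ N, r < 1 / (8 * (denPair (pre s n)).1 ^ 2) ∧
      1 / (8 * (denPair (pre s (n + 1))).1 ^ 2) ≤ r := by
  classical
  have h2 : ∀ n, ∀ a ∈ pre s n, 2 ≤ a := fun n => pre_mem (E := {a | 2 ≤ a}) hs n
  have hex : ∃ m, 1 / (8 * (denPair (pre s m)).1 ^ 2) ≤ r := by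
    obtain ⟨m, hm⟩ := exists_pow_lt_of_lt_one hr (show (1 / 4 : ℝ) < 1 by norm_num)
    refine ⟨m, le_trans ?_ hm.le⟩
    have := (denPair_bounds (h2 m)).2.2
    rw [pre_length] at this
    have e : (1 / 4 : ℝ) ^ m = 1 / (2 ^ m) ^ 2 := by
      rw [← pow_mul, mul_comm, pow_mul, div_pow]; norm_num
    rw [e]
    refine one_div_le_one_div_of_le (by positivity) ?_
    nlinarith [pow_le_pow_left₀ (by positivity) this 2]
  have hmono : Monotone fun n => (denPair (pre s n)).1 := by
    refine monotone_nat_of_le_succ fun n => ?_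
    rw [pre_succ, denPair_concat]
    have h3 : (2 : ℝ) ≤ s n := by exact_mod_cast hs n
    nlinarith [(denPair_bounds (h2 n)).1, denPair_pos (h2 n)]
  have hlt : N < Nat.find hex := by
    by_contra! hle
    have h4 : (denPair (pre s (Nat.find hex))).1 ≤ (denPair (pre s N)).1 := hmono hle
    have h5 := denPair_pos (h2 (Nat.find hex))
    have h6 : 1 / (8 * (denPair (pre s N)).1 ^ 2) ≤
        1 / (8 * (denPair (pre s (Nat.find hex))).1 ^ 2) := by gcongr
    linarith [Nat.find_spec hex]
  obtain ⟨n, hn⟩ := Nat.exists_eq_add_of_lt hlt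
  have hspec := Nat.find_spec hex
  rw [hn] at hspec
  exact ⟨N + n, by omega, not_le.1 (Nat.find_min hex (by omega)), hspec⟩

/-- Almost everywhere upper bound for the mass of small balls. -/
lemma ae_eventually_measure_closedBall_le (hE : ∀ a ∈ E, 2 ≤ a) (hμ : IsConformal E δ μ)
    (hδ1 : δ < 1) {τ κ : ℝ} (hτ : 0 < τ) (hτδ : τ < 2 * δ - 1) (hκ : 1 < κ * τ) :
    ∃ C : ℝ, 0 < C ∧ ∀ᵐ x ∂μ, ∀ᶠ r in 𝓝[>] (0 : ℝ),
      μ (closedBall x r) ≤ ENNReal.ofReal (C * (r ^ δ * Real.log (1 / r) ^ (κ * (δ - τ)))) := by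
  have hδ : 0 < δ := by linarith
  have hβ : 0 < δ - τ := by linarith
  obtain ⟨C, hC, hball⟩ := measure_closedBall_le hE hμ hδ1 hτ hτδ
  refine ⟨C * 4 ^ δ, by positivity, ?_⟩
  filter_upwards [ae_eventually_tail_ge hE hμ hδ hτ hτδ hκ] with x hx
  obtain ⟨s, hs, rfl, hev⟩ := hx
  obtain ⟨N, hN⟩ := eventually_atTop.1 hev
  have hs2 : ∀ k, 2 ≤ s k := fun k => hE _ (hs k)
  have h2 : ∀ n, ∀ a ∈ pre s n, 2 ≤ a := fun n => pre_mem (E := {a | 2 ≤ a}) hs2 n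
  have hqN := denPair_pos (h2 N)
  filter_upwards [Ioo_mem_nhdsGT
    (show (0 : ℝ) < 1 / (8 * (denPair (pre s N)).1 ^ 2) by positivity)] with r hr
  obtain ⟨n, hnN, hn1, hn2⟩ := exists_scale hs2 hr.1 hr.2
  have hr0 : 0 < r := hr.1
  have hyt := hN n hnN
  have hyE : codingMap (fun k => s (k + n)) ∈ limitSet E := ⟨_, fun k => hs _, rfl⟩
  have hx := codingMap_eq_wordMap hs2 n
  have hyeq := codingMap_eq (s := fun k => s (k + n)) fun k => hs2 _
  have hw0 := (codingMap_mem_Icc (s := fun k => s (k + 1 + n)) fun k => hs2 _).1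
  obtain ⟨hy0, hy1⟩ := limitSet_subset hE hyE
  set y := codingMap fun k => s (k + n)
  have hya : y * s n ≤ 1 := by
    have : (2 : ℝ) ≤ s n := by exact_mod_cast hs2 n
    rw [hyeq, gaussMap, zero_add, one_div_mul_eq_div, div_le_one (by linarith)]
    linarith
  have hq := denPair_pos (h2 n)
  have hq' := denPair_pos (h2 (n + 1))
  obtain ⟨hp, hpq, hqn⟩ := denPair_bounds (h2 n)
  rw [pre_length] at hqn
  have hyq : y * (denPair (pre s (n + 1))).1 ≤ 3 / 2 * (denPair (pre s n)).1 := by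
    rw [pre_succ, denPair_concat]
    nlinarith [mul_le_mul_of_nonneg_right hya hq.le, mul_le_mul hy1 hpq hp (by norm_num)]
  set q := (denPair (pre s n)).1
  set q₁ := (denPair (pre s (n + 1))).1
  have hρ : y ^ 2 / 8 ≤ 4 * q ^ 2 * r := by
    have e1 : y ^ 2 * q₁ ^ 2 ≤ 9 / 4 * q ^ 2 := by
      have := pow_le_pow_left₀ (by positivity) hyq 2
      nlinarith
    rw [div_le_iff₀ (by positivity)] at hn2
    have e2 : y ^ 2 ≤ y ^ 2 * q₁ ^ 2 * (8 * r) := by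
      nlinarith [mul_le_mul_of_nonneg_left hn2 (sq_nonneg y)]
    have e3 : y ^ 2 * q₁ ^ 2 * (8 * r) ≤ 9 / 4 * q ^ 2 * (8 * r) := by gcongr
    nlinarith [mul_pos (pow_pos hq 2) hr0]
  have hlog : (n : ℝ) + 1 ≤ Real.log (1 / r) := by
    rw [Real.le_log_iff_exp_le (by positivity)]
    have e1 : Real.exp ((n : ℝ) + 1) ≤ 3 ^ (n + 1) := by
      have := pow_le_pow_left₀ (Real.exp_pos 1).le Real.exp_one_lt_three.le (n + 1)
      rw [← Real.exp_nat_mul] at this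
      simpa using this
    have e2 : (3 : ℝ) ^ (n + 1) ≤ 8 * q ^ 2 := by
      have e3 : (3 : ℝ) ^ n ≤ 4 ^ n := pow_le_pow_left₀ (by norm_num) (by norm_num) n
      have e4 : (4 : ℝ) ^ n ≤ q ^ 2 := by
        have := pow_le_pow_left₀ (by positivity) hqn 2
        rw [← pow_mul, mul_comm, pow_mul] at this
        norm_num at this
        exact this
      have e5 : (0 : ℝ) < 3 ^ n := by positivity
      rw [pow_succ]; linarith
    refine (e1.trans e2).trans ?_
    rw [lt_div_iff₀ (by positivity)] at hn1
    rw [le_div_iff₀ hr0]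
    linarith
  have hyβ : y ^ (-(δ - τ)) ≤ Real.log (1 / r) ^ (κ * (δ - τ)) := by
    have hκ0 : 0 < κ := by
      by_contra hneg
      nlinarith [mul_nonneg (neg_nonneg.2 (not_lt.1 hneg)) hτ.le]
    refine (Real.rpow_le_rpow_of_nonpos (by positivity) hyt (by linarith)).trans ?_
    rw [← Real.rpow_mul (by positivity), neg_mul_neg]
    exact Real.rpow_le_rpow (by positivity) hlog (by positivity)
  have hsub : closedBall (wordMap (pre s n) y) r ≤ᵐ[μ]
      wordMap (pre s n) '' (closedBall y (4 * q ^ 2 * r) ∩ Ioo 0 1) := by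
    filter_upwards [hμ.ae_mem] with z hz hzr
    exact ball_inter_limitSet_subset hE (pre_mem hs n) hyE hn1 ⟨hzr, hz⟩
  rw [hx]
  refine (measure_mono_ae hsub).trans ((measure_wordMap_image_le hE hμ hδ (pre_mem hs n)
    inter_subset_right (measurableSet_closedBall.inter measurableSet_Ioo)).trans ?_)
  calc ENNReal.ofReal (q ^ (-(2 * δ))) * μ (closedBall y (4 * q ^ 2 * r) ∩ Ioo 0 1)
      ≤ ENNReal.ofReal (q ^ (-(2 * δ))) *
          ENNReal.ofReal (C * (4 * q ^ 2 * r) ^ δ * y ^ (-(δ - τ))) := by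
        gcongr
        exact (measure_mono inter_subset_left).trans (hball y hyE _ hρ)
    _ = ENNReal.ofReal (C * 4 ^ δ * (r ^ δ * y ^ (-(δ - τ)))) := by
        rw [← ENNReal.ofReal_mul (by positivity)]
        congr 1
        have e : q ^ (-(2 * δ)) * (q ^ 2) ^ δ = 1 := by
          rw [← Real.rpow_natCast, ← Real.rpow_mul hq.le, ← Real.rpow_add hq]
          simp
        rw [Real.mul_rpow (by positivity) hr0.le, Real.mul_rpow (by norm_num) (by positivity)]
        calc _ = (q ^ (-(2 * δ)) * (q ^ 2) ^ δ) * (C * 4 ^ δ * (r ^ δ * y ^ (-(δ - τ)))) := by ring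
          _ = _ := by rw [e, one_mul]
    _ ≤ _ := by
        refine ENNReal.ofReal_le_ofReal ?_
        gcongr

lemma hausdorffPsi_eq_top (hE : ∀ a ∈ E, 2 ≤ a) (hμ : IsConformal E δ μ) (hδ : 1 / 2 < δ)
    (hδ1 : δ < 1) {s : ℝ} (hs : (1 - δ) / (2 * δ - 1) < s) {A : Set ℝ} (hA : μ Aᶜ = 0) :
    hausdorffPsi (fun r : ℝ => r ^ δ * Real.log (1 / r) ^ s) A = ⊤ := by
  have := hμ.1
  have hs0 : 0 < s := lt_trans (div_pos (by linarith) (by linarith)) hs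
  have h1 : δ / (1 + s) < 2 * δ - 1 := by
    rw [div_lt_iff₀ (by linarith)] at hs ⊢
    linarith
  obtain ⟨τ, hτ1, hτ2⟩ := exists_between h1
  have hτ : 0 < τ := lt_trans (by positivity) hτ1
  have hβ : 0 < δ - τ := by linarith
  have h2 : 1 / τ < s / (δ - τ) := by
    rw [div_lt_iff₀ (by linarith)] at hτ1
    rw [div_lt_div_iff₀ hτ hβ]
    linarith
  obtain ⟨κ, hκ1, hκ2⟩ := exists_between h2
  rw [div_lt_iff₀ hτ] at hκ1
  rw [lt_div_iff₀ hβ] at hκ2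
  obtain ⟨C, hC, hae⟩ := ae_eventually_measure_closedBall_le hE hμ hδ1 hτ hτ2 hκ1
  have key : ∀ α : ℝ, 0 < α → 1 ≤ ENNReal.ofReal α *
      hausdorffPsi (fun r : ℝ => r ^ δ * Real.log (1 / r) ^ s) A := by
    intro α hα
    refine one_le_mul_hausdorffPsi hα (tendsto_rpow_mul_log (by linarith) hs0) ?_ hA
    have hlarge : ∀ᶠ r in 𝓝[>] (0 : ℝ), C / α ≤ Real.log (1 / r) ^ (s - κ * (δ - τ)) :=
      ((tendsto_rpow_atTop (by linarith)).comp tendsto_log_one_div).eventually_ge_atTop _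
    filter_upwards [hae] with x hx
    filter_upwards [hx, hlarge, self_mem_nhdsWithin, tendsto_log_one_div.eventually_gt_atTop 0]
      with r h3 h4 h5 h6
    refine h3.trans (ENNReal.ofReal_le_ofReal ?_)
    have h5 : 0 < r := h5
    have e : Real.log (1 / r) ^ s =
        Real.log (1 / r) ^ (s - κ * (δ - τ)) * Real.log (1 / r) ^ (κ * (δ - τ)) := by
      rw [← Real.rpow_add h6]; congr 1; ring
    rw [div_le_iff₀ hα] at h4
    rw [e]
    calc _ ≤ (Real.log (1 / r) ^ (s - κ * (δ - τ)) * α) *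
          (r ^ δ * Real.log (1 / r) ^ (κ * (δ - τ))) := by gcongr
      _ = _ := by ring
  by_contra htop
  set H := hausdorffPsi (fun r : ℝ => r ^ δ * Real.log (1 / r) ^ s) A
  have h3 := key (1 / (2 * (H.toReal + 1))) (by positivity)
  rw [← ENNReal.ofReal_toReal htop, ← ENNReal.ofReal_mul (by positivity),
    ENNReal.one_le_ofReal, ENNReal.ofReal_toReal htop, one_div_mul_eq_div,
    one_le_div (by positivity)] at h3
  linarith [ENNReal.toReal_nonneg (a := H)]

end Density

/-- Remark after Theorem 1. For `ψ(r) = r^δ log^s(1/r)` with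
`s > (1-δ)/(2δ-1)`, we have `H^ψ(μ_P) = ∞` and hence `H^ψ(Λ_P) = ∞`. -/
theorem stmt2 (δ : ℝ) (hδ₁ : 1 / 2 < δ) (hδ₂ : δ < 1) (hpress : pressure primes δ = 0)
    (μ : Measure ℝ) (hμ : IsConformal primes δ μ)
    (s : ℝ) (hs : (1 - δ) / (2 * δ - 1) < s)
    (ψ : ℝ → ℝ) (hψ : ψ = fun r : ℝ => r ^ δ * Real.log (1 / r) ^ s) :
    hausdorffPsiOf ψ μ = ⊤ ∧ hausdorffPsi ψ (limitSet primes) = ⊤ := by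
  have hE : ∀ a ∈ primes, 2 ≤ a := fun a ha => Nat.Prime.two_le ha
  subst hψ
  refine ⟨?_, hausdorffPsi_eq_top hE hμ hδ₁ hδ₂ hs hμ.2.1⟩
  simp only [hausdorffPsiOf, iInf_eq_top]
  exact fun A _ hA => hausdorffPsi_eq_top hE hμ hδ₁ hδ₂ hs hA

end
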